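/- arXiv:2412.20111 — 2 statements merged into one kernel-verified Lean document; each statement's English description precedes it below -/
import Mathlib

section
/- Burton–Pemantle theorem: for a finite connected weighted graph and any finite collection of distinct edges e₁,…,e_k, the probability under the (weighted) uniform spanning tree measure that all of e₁,…,e_k belong to the tree equals the determinant of the k×k transfer-impedance matrix (T(eᵢ,eⱼ))ᵢⱼ. -/
noncomputable section
open Classical

/-- The Laplacian matrix of a weighted graph. -/
def lap {V : Type*} [Fintype V] [DecidableEq V] (G : SimpleGraph V)
    (w : Sym2 V → ℝ) : Matrix V V ℝ :=
  fun u v =>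
    if G.Adj u v then w s(u, v)
    else if u = v then -(∑ x : V, if G.Adj u x then w s(u, x) else 0)
    else 0

/-- The inverse of the reduced negative Laplacian `O = -Δ_{o^c,o^c}`, extended by `0`
on the row/column of the root `o`. -/
def redLapInv {V : Type*} [Fintype V] [DecidableEq V] (G : SimpleGraph V)
    (w : Sym2 V → ℝ) (o : V) : V → V → ℝ :=
  fun u v =>
    if hu : u = o then 0
    else if hv : v = o then 0
    else (Matrix.of fun a b : {x : V // x ≠ o} => -(lap G w a.1 b.1))⁻¹ ⟨u, hu⟩ ⟨v, hv⟩

/-- The weighted number of spanning trees of `G` satisfying a predicate `P`. -/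
def treeSum {V : Type*} [Fintype V] [DecidableEq V] (G : SimpleGraph V)
    (w : Sym2 V → ℝ) (P : SimpleGraph V → Prop) : ℝ :=
  ∑ T : SimpleGraph V,
    if T ≤ G ∧ T.IsTree ∧ P T then ∏ e ∈ Finset.univ.filter (· ∈ T.edgeSet), w e else 0

namespace BurtonPemantle

open Finset Matrix

/-- Weak form of the Cauchy–Binet formula, summing over all maps instead of over subsets. -/
theorem factorial_mul_det_mul {n m R : Type*} [Fintype n] [DecidableEq n] [Fintype m]
    [CommRing R] (M : Matrix n m R) (N : Matrix m n R) :
    ((Fintype.card n).factorial : R) * (M * N).det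
      = ∑ f : n → m, (M.submatrix id f).det * (N.submatrix f id).det := by
  have hexp : (M * N).det = ∑ f : n → m, (∏ i, M i (f i)) * (N.submatrix f id).det := by
    have h := (detRowAlternating (n := n) (R := R)).toMultilinearMap.map_sum
      (fun i (j : m) => M i j • N.row j)
    have hMN : (fun i => ∑ j, M i j • N.row j) = M * N := by
      ext i k
      simp [Matrix.mul_apply, Finset.sum_apply]
    rw [hMN] at h
    refine h.trans (Finset.sum_congr rfl fun f _ => ?_)
    rw [MultilinearMap.map_smul_univ]
    rfl
  have hperm (σ : Equiv.Perm n) : (M * N).det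
      = ∑ f : n → m, ((Equiv.Perm.sign σ : ℤ) : R) * (∏ i, M i (f (σ i)))
          * (N.submatrix f id).det := by
    rw [hexp, ← (Equiv.arrowCongr σ⁻¹ (Equiv.refl m)).sum_comp]
    refine Finset.sum_congr rfl fun f _ => ?_
    have : N.submatrix (f ∘ σ) id = (N.submatrix f id).submatrix σ id := rfl
    change (∏ i, M i (f (σ i))) * (N.submatrix (f ∘ σ) id).det = _
    rw [this, det_permute]
    ring
  have hsum : ∑ σ : Equiv.Perm n, (M * N).det = ((Fintype.card n).factorial : R) * (M * N).det := by
    simp [Fintype.card_perm]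
  rw [← hsum, Finset.sum_congr rfl fun σ _ => hperm σ, Finset.sum_comm]
  refine Finset.sum_congr rfl fun f _ => ?_
  rw [← Finset.sum_mul, ← det_transpose (M.submatrix id f), det_apply' (M.submatrix id f)ᵀ]
  rfl

variable {V : Type*}

theorem out_eq_or (p : V × V) :
    Quot.out (s(p.1, p.2)) = p ∨ Quot.out (s(p.1, p.2)) = p.swap := by
  have h : s((Quot.out s(p.1, p.2)).1, (Quot.out s(p.1, p.2)).2) = s(p.1, p.2) :=
    Quot.out_eq _
  rcases Sym2.eq_iff.1 h with h | h
  · exact .inl (Prod.ext h.1 h.2)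
  · exact .inr (Prod.ext h.1 h.2)

variable [DecidableEq V]

/-- The signed indicator `1_x - 1_y` of the oriented edge `x → y`. -/
def bdry (R : Type*) [Ring R] (p : V × V) (v : V) : R :=
  (if v = p.1 then 1 else 0) - (if v = p.2 then 1 else 0)

/-- The reduced incidence matrix, each edge carrying an arbitrary orientation. -/
def redInc (R : Type*) [Ring R] (o : V) : Matrix {x : V // x ≠ o} (Sym2 V) R :=
  Matrix.of fun v e => bdry R (Quot.out e) v

theorem bdry_swap (R : Type*) [Ring R] (p : V × V) (v : V) :
    bdry R p.swap v = -bdry R p v := by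
  simp [bdry]

theorem redInc_eq_or (R : Type*) [Ring R] (o : V) (p : V × V) :
    (∀ v : {x : V // x ≠ o}, redInc R o v s(p.1, p.2) = bdry R p v) ∨
      ∀ v : {x : V // x ≠ o}, redInc R o v s(p.1, p.2) = -bdry R p v := by
  rcases out_eq_or p with h | h
  · exact .inl fun v => by rw [redInc, of_apply, h]
  · exact .inr fun v => by rw [redInc, of_apply, h, bdry_swap]

theorem redInc_mul_redInc (R : Type*) [Ring R] (o : V) (p : V × V) (u v : {x : V // x ≠ o}) :
    redInc R o u s(p.1, p.2) * redInc R o v s(p.1, p.2) = bdry R p u * bdry R p v := by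
  rcases redInc_eq_or R o p with h | h <;> simp [h]

theorem redInc_mul_redInc_of_ne (o : V) (e : Sym2 V) (u v : {x : V // x ≠ o}) (h : u ≠ v) :
    redInc ℝ o u e * redInc ℝ o v e = if e = s(u.1, v.1) then -1 else 0 := by
  induction e with | _ x y
  rw [redInc_mul_redInc ℝ o (x, y)]
  have h' : u.1 ≠ v.1 := fun h' => h (Subtype.ext h')
  simp only [bdry, Sym2.eq_iff]
  grind

variable [Fintype V]

/-- The reduced negative Laplacian. -/
def redLap (G : SimpleGraph V) (w : Sym2 V → ℝ) (o : V) :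
    Matrix {x : V // x ≠ o} {x : V // x ≠ o} ℝ :=
  Matrix.of fun a b => -(lap G w a.1 b.1)

theorem sum_mul_bdry {R : Type*} [Ring R] (o : V) (χ : V → R) (hχ : χ o = 0) (p : V × V) :
    ∑ v : {x : V // x ≠ o}, χ v * bdry R p v = χ p.1 - χ p.2 := by
  have h (x : V) : ∑ v : {x : V // x ≠ o}, χ v * (if (v : V) = x then 1 else 0) = χ x := by
    by_cases hx : x = o
    · subst hx
      rw [hχ]
      exact Finset.sum_eq_zero fun v _ => by simp [v.2]
    · rw [Finset.sum_eq_single ⟨x, hx⟩]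
      · simp
      · intro v _ hv
        rw [if_neg fun h => hv (Subtype.ext h), mul_zero]
      · simp
  simp only [bdry, mul_sub, Finset.sum_sub_distrib, h]

/-- The weight function supported on the edges of `G`. -/
def edgeWeight (G : SimpleGraph V) (w : Sym2 V → ℝ) (e : Sym2 V) : ℝ :=
  if e ∈ G.edgeSet then w e else 0

theorem redInc_mul_self (o : V) (e : Sym2 V) (u : {x : V // x ≠ o}) :
    redInc ℝ o u e * redInc ℝ o u e
      = ∑ x : V, if e = s(u.1, x) then (if x = u then 0 else 1) else 0 := by
  induction e with | _ a b
  rw [redInc_mul_redInc ℝ o (a, b)]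
  simp only [bdry, Sym2.eq_iff]
  by_cases ha : a = u
  · rw [Finset.sum_eq_single b]
    · grind
    · grind
    · simp
  · by_cases hb : b = u
    · rw [Finset.sum_eq_single a]
      · grind
      · grind
      · simp
    · rw [Finset.sum_eq_zero]
      · grind
      · grind

theorem redLap_eq (G : SimpleGraph V) (w : Sym2 V → ℝ) (o : V) :
    redLap G w o = redInc ℝ o * diagonal (edgeWeight G w) * (redInc ℝ o)ᵀ := by
  ext u v
  rw [mul_apply]
  simp only [mul_diagonal, transpose_apply]
  by_cases h : u = v
  · subst h
    have (e : Sym2 V) : redInc ℝ o u e * edgeWeight G w e * redInc ℝ o u e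
        = ∑ x : V, if e = s(u.1, x) then (if x = u then 0 else edgeWeight G w e) else 0 := by
      rw [mul_right_comm, redInc_mul_self, Finset.sum_mul]
      exact Finset.sum_congr rfl fun x _ => by split_ifs <;> simp
    simp only [this]
    rw [Finset.sum_comm]
    simp only [Finset.sum_ite_eq', Finset.mem_univ, if_true]
    simp only [redLap, lap, of_apply, SimpleGraph.irrefl, if_false, if_true, neg_neg, edgeWeight,
      SimpleGraph.mem_edgeSet]
    refine Finset.sum_congr rfl fun x _ => ?_
    by_cases hx : x = u
    · simp [hx]
    · simp [hx]
  · have (e : Sym2 V) : redInc ℝ o u e * edgeWeight G w e * redInc ℝ o v e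
        = if e = s(u.1, v.1) then -edgeWeight G w e else 0 := by
      rw [mul_right_comm, redInc_mul_redInc_of_ne o e u v h]
      split_ifs <;> simp
    have h' : u.1 ≠ v.1 := fun h' => h (Subtype.ext h')
    simp only [this, Finset.sum_ite_eq', Finset.mem_univ, if_true]
    simp only [redLap, lap, of_apply, h', if_false, edgeWeight, SimpleGraph.mem_edgeSet]

/-- The determinant of the reduced incidence matrix with columns selected by `f`. -/
def incDet (o : V) (f : {x : V // x ≠ o} → Sym2 V) : ℤ :=
  ((redInc ℤ o).submatrix id f).det

theorem incDet_cast (o : V) (f : {x : V // x ≠ o} → Sym2 V) :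
    ((incDet o f : ℤ) : ℝ) = ((redInc ℝ o).submatrix id f).det := by
  rw [incDet, Int.cast_det]
  congr 1
  ext i j
  simp [redInc, bdry]

theorem injective_of_incDet_ne_zero {o : V} {f : {x : V // x ≠ o} → Sym2 V}
    (h : incDet o f ≠ 0) : Function.Injective f := by
  intro i j hij
  by_contra hne
  exact h (det_zero_of_column_eq hne fun k => by simp [hij])

theorem not_isDiag_of_incDet_ne_zero {o : V} {f : {x : V // x ≠ o} → Sym2 V}
    (h : incDet o f ≠ 0) (j : {x : V // x ≠ o}) : ¬(f j).IsDiag := by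
  intro hd
  refine h (det_eq_zero_of_column_eq_zero j fun i => ?_)
  generalize hj : f j = e at hd
  induction e with | _ x y
  obtain rfl : x = y := hd
  rw [submatrix_apply, hj]
  rcases redInc_eq_or ℤ o (x, x) with h | h <;> exact (h _).trans (by simp [bdry])

theorem connected_of_incDet_ne_zero {o : V} {f : {x : V // x ≠ o} → Sym2 V}
    (h : incDet o f ≠ 0) : (SimpleGraph.fromEdgeSet (Set.range f)).Connected := by
  set H := SimpleGraph.fromEdgeSet (Set.range f) with hH
  suffices hreach : ∀ v, H.Reachable v o from
    { preconnected := fun u v => (hreach u).trans (hreach v).symm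
      nonempty := ⟨o⟩ }
  intro v
  by_contra hv
  refine h (exists_vecMul_eq_zero_iff.1
    ⟨fun i => if H.Reachable v i then 1 else 0, ?_, ?_⟩)
  · intro h0
    have hvo : v ≠ o := fun h => hv (h ▸ SimpleGraph.Reachable.refl v)
    simpa using congrFun h0 ⟨v, hvo⟩
  · ext j
    have := sum_mul_bdry o (fun i => if H.Reachable v i then (1 : ℤ) else 0) (if_neg hv)
      (Quot.out (f j))
    refine this.trans ?_
    have he : s((Quot.out (f j)).1, (Quot.out (f j)).2) = f j := Quot.out_eq _
    have hxy : H.Reachable (Quot.out (f j)).1 (Quot.out (f j)).2 := by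
      by_cases hne : (Quot.out (f j)).1 = (Quot.out (f j)).2
      · rw [hne]
      · exact SimpleGraph.Adj.reachable
          ((SimpleGraph.fromEdgeSet_adj _).2 ⟨⟨j, he.symm⟩, hne⟩)
    have : H.Reachable v (Quot.out (f j)).1 ↔ H.Reachable v (Quot.out (f j)).2 :=
      ⟨fun h => h.trans hxy, fun h => h.trans hxy.symm⟩
    simp [this]

theorem edgeSet_fromEdgeSet_range {o : V} {f : {x : V // x ≠ o} → Sym2 V}
    (h : incDet o f ≠ 0) : (SimpleGraph.fromEdgeSet (Set.range f)).edgeSet = Set.range f := by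
  rw [SimpleGraph.edgeSet_fromEdgeSet, sdiff_eq_left, Set.disjoint_left]
  rintro _ ⟨j, rfl⟩
  exact not_isDiag_of_incDet_ne_zero h j

theorem isTree_of_incDet_ne_zero {o : V} {f : {x : V // x ≠ o} → Sym2 V}
    (h : incDet o f ≠ 0) : (SimpleGraph.fromEdgeSet (Set.range f)).IsTree := by
  refine SimpleGraph.isTree_iff_connected_and_card.2 ⟨connected_of_incDet_ne_zero h, ?_⟩
  rw [edgeSet_fromEdgeSet_range h,
    ← Nat.card_congr (Equiv.ofInjective f (injective_of_incDet_ne_zero h)),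
    Nat.card_eq_fintype_card, Nat.card_eq_fintype_card, Fintype.card_subtype_compl,
    Fintype.card_subtype_eq]
  have := Fintype.card_pos_iff.2 ⟨o⟩
  omega

theorem incDet_sq {o : V} {f : {x : V // x ≠ o} → Sym2 V} {T : SimpleGraph V}
    (hT : T.Connected) (hf : Set.range f = T.edgeSet) : incDet o f ^ 2 = 1 := by
  have key (v : V) : ∃ c : {x : V // x ≠ o} → ℤ, ∀ i : {x : V // x ≠ o},
      ∑ j, redInc ℤ o i (f j) * c j = if (i : V) = v then 1 else 0 := by
    have hstep (u v : V) (huv : T.Adj u v) (hu : ∃ c : {x : V // x ≠ o} → ℤ,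
        ∀ i : {x : V // x ≠ o}, ∑ j, redInc ℤ o i (f j) * c j = if (i : V) = u then 1 else 0) :
        ∃ c : {x : V // x ≠ o} → ℤ, ∀ i : {x : V // x ≠ o},
          ∑ j, redInc ℤ o i (f j) * c j = if (i : V) = v then 1 else 0 := by
      obtain ⟨c, hc⟩ := hu
      obtain ⟨j, hj⟩ : s(v, u) ∈ Set.range f := by
        rw [hf]
        exact huv.symm
      rcases redInc_eq_or ℤ o (v, u) with h | h
      · refine ⟨c + Pi.single j 1, fun i => ?_⟩
        simp only [Pi.add_apply, mul_add, Finset.sum_add_distrib, hc, Pi.single_apply, mul_ite,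
          mul_one, mul_zero, Finset.sum_ite_eq', Finset.mem_univ, if_true, hj]
        rw [h i, bdry]
        ring
      · refine ⟨c - Pi.single j 1, fun i => ?_⟩
        simp only [Pi.sub_apply, mul_sub, Finset.sum_sub_distrib, hc, Pi.single_apply, mul_ite,
          mul_one, mul_zero, Finset.sum_ite_eq', Finset.mem_univ, if_true, hj]
        rw [h i, bdry]
        ring
    have hwalk : ∀ {a b : V}, T.Walk a b → (∃ c : {x : V // x ≠ o} → ℤ,
        ∀ i : {x : V // x ≠ o}, ∑ j, redInc ℤ o i (f j) * c j = if (i : V) = a then 1 else 0) →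
        ∃ c : {x : V // x ≠ o} → ℤ, ∀ i : {x : V // x ≠ o},
          ∑ j, redInc ℤ o i (f j) * c j = if (i : V) = b then 1 else 0 := by
      intro a b p
      induction p with
      | nil => exact id
      | cons hadj _ ih => exact fun h => ih (hstep _ _ hadj h)
    obtain ⟨p⟩ := hT.preconnected o v
    exact hwalk p ⟨0, fun i => by simp [i.2]⟩
  choose c hc using key
  have hmul : (redInc ℤ o).submatrix id f * Matrix.of (fun j (v : {x : V // x ≠ o}) => c v j)
      = 1 := by
    ext i v
    rw [mul_apply]
    refine (hc v i).trans ?_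
    simp [one_apply, Subtype.ext_iff]
  have hdet := congrArg det hmul
  rw [det_mul, det_one] at hdet
  exact Int.isUnit_sq (IsUnit.of_mul_eq_one _ hdet)

theorem card_filter_range_eq {α β : Type*} [Fintype α] [DecidableEq α] [Fintype β]
    (s : Set β) (hs : Nat.card s = Fintype.card α) :
    #{f : α → β | Function.Injective f ∧ Set.range f = s} = (Fintype.card α).factorial := by
  have hcard : Fintype.card α = Fintype.card s := by rw [← hs, Nat.card_eq_fintype_card]
  have hequiv := Fintype.card_equiv (Fintype.equivOfCardEq hcard)
  rw [← Finset.card_univ] at hequiv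
  rw [← hequiv]
  symm
  refine Finset.card_bij (fun φ _ a => (φ a : β)) ?_ ?_ ?_
  · intro φ _
    simp only [Finset.mem_filter, Finset.mem_univ, true_and]
    refine ⟨Subtype.val_injective.comp φ.injective, ?_⟩
    change Set.range (Subtype.val ∘ φ) = s
    rw [φ.surjective.range_comp, Subtype.range_coe]
  · intro φ _ ψ _ h
    ext a
    exact congrFun h a
  · intro f hf
    simp only [Finset.mem_filter, Finset.mem_univ, true_and] at hf
    obtain ⟨hinj, hf⟩ := hf
    exact ⟨(Equiv.ofInjective f hinj).trans (Equiv.setCongr hf), Finset.mem_univ _, rfl⟩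

theorem prod_edgeWeight_mul_incDet_sq (G : SimpleGraph V) (w : Sym2 V → ℝ) (o : V)
    (f : {x : V // x ≠ o} → Sym2 V) :
    (∏ v, edgeWeight G w (f v)) * (incDet o f : ℝ) ^ 2
      = ∑ T : SimpleGraph V, if Function.Injective f ∧ Set.range f = T.edgeSet then
          (if T ≤ G ∧ T.IsTree ∧ True then
            ∏ e ∈ Finset.univ.filter (· ∈ T.edgeSet), w e else 0) else 0 := by
  by_cases h : incDet o f = 0
  · rw [h, Finset.sum_eq_zero]
    · simp
    · intro T _
      split_ifs with h1 h2
      · have := incDet_sq h2.2.1.connected h1.2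
        simp [h] at this
      · rfl
      · rfl
  · have hE := edgeSet_fromEdgeSet_range h
    have hT := isTree_of_incDet_ne_zero h
    have hinj := injective_of_incDet_ne_zero h
    have hsq : (incDet o f : ℝ) ^ 2 = 1 := by
      exact_mod_cast incDet_sq hT.connected hE.symm
    rw [hsq, mul_one, Finset.sum_eq_single (SimpleGraph.fromEdgeSet (Set.range f))]
    · rw [if_pos ⟨hinj, hE.symm⟩]
      split_ifs with hG
      · refine Eq.trans ?_ (Finset.prod_congr
          (show Finset.univ.image f = _ by ext e; simp [hE]) fun _ _ => rfl)
        rw [Finset.prod_image hinj.injOn]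
        refine Finset.prod_congr rfl fun v _ => if_pos ?_
        exact SimpleGraph.edgeSet_mono hG.1 (hE.symm.subset (Set.mem_range_self v))
      · have : ∃ v, f v ∉ G.edgeSet := by
          by_contra! hall
          refine hG ⟨SimpleGraph.edgeSet_subset_edgeSet.1 ?_, hT, trivial⟩
          rw [hE]
          rintro _ ⟨v, rfl⟩
          exact hall v
        obtain ⟨v, hv⟩ := this
        exact Finset.prod_eq_zero (Finset.mem_univ v) (if_neg hv)
    · intro T _ hne
      refine if_neg fun hr => hne ?_
      rw [hr.2, SimpleGraph.fromEdgeSet_edgeSet]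
    · simp

/-- The weighted matrix-tree theorem. -/
theorem det_redLap (G : SimpleGraph V) (w : Sym2 V → ℝ) (o : V) :
    (redLap G w o).det = treeSum G w (fun _ => True) := by
  have hfac : ((Fintype.card {x : V // x ≠ o}).factorial : ℝ) ≠ 0 := by positivity
  refine mul_left_cancel₀ hfac ?_
  rw [redLap_eq, factorial_mul_det_mul]
  have hterm (f : {x : V // x ≠ o} → Sym2 V) :
      ((redInc ℝ o * diagonal (edgeWeight G w)).submatrix id f).det
        * ((redInc ℝ o)ᵀ.submatrix f id).det
        = (∏ v, edgeWeight G w (f v)) * (incDet o f : ℝ) ^ 2 := by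
    have h1 : (redInc ℝ o * diagonal (edgeWeight G w)).submatrix id f
        = Matrix.of fun i j => edgeWeight G w (f j) * (redInc ℝ o).submatrix id f i j := by
      ext i j
      simp [mul_comm]
    have h2 : (redInc ℝ o)ᵀ.submatrix f id = ((redInc ℝ o).submatrix id f)ᵀ := rfl
    rw [h1, h2, det_transpose, det_mul_row, incDet_cast]
    ring
  simp only [hterm, prod_edgeWeight_mul_incDet_sq]
  rw [Finset.sum_comm, treeSum, Finset.mul_sum]
  refine Finset.sum_congr rfl fun T _ => ?_
  rw [← Finset.sum_filter, Finset.sum_const, nsmul_eq_mul]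
  split_ifs with hT
  · have hcard : Nat.card T.edgeSet = Fintype.card {x : V // x ≠ o} := by
      have h1 := (SimpleGraph.isTree_iff_connected_and_card.1 hT.2.1).2
      rw [Nat.card_eq_fintype_card (α := V)] at h1
      rw [Fintype.card_subtype_compl, Fintype.card_subtype_eq]
      omega
    rw [← card_filter_range_eq T.edgeSet hcard]
    congr!
  · simp

theorem treeSum_pos (G : SimpleGraph V) (w : Sym2 V → ℝ) (hw : ∀ e ∈ G.edgeSet, 0 < w e)
    (hconn : G.Connected) : 0 < treeSum G w (fun _ => True) := by
  have hprod (T : SimpleGraph V) (hT : T ≤ G) :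
      0 < ∏ e ∈ Finset.univ.filter (· ∈ T.edgeSet), w e :=
    Finset.prod_pos fun e he => hw e (SimpleGraph.edgeSet_mono hT (Finset.mem_filter.1 he).2)
  obtain ⟨T, hTG, hT⟩ := hconn.exists_isTree_le
  refine Finset.sum_pos' (fun T _ => ?_) ⟨T, Finset.mem_univ _, ?_⟩
  · split_ifs with h
    · exact (hprod T h.1).le
    · rfl
  · rw [if_pos ⟨hTG, hT, trivial⟩]
    exact hprod T hTG

theorem redLapInv_eq (G : SimpleGraph V) (w : Sym2 V → ℝ) (o : V) (u v : {x : V // x ≠ o}) :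
    redLapInv G w o u v = (redLap G w o)⁻¹ u v := by
  rw [redLapInv, dif_neg u.2, dif_neg v.2]
  rfl

/-- The reduced incidence matrix of a family of oriented edges. -/
def famInc {ι : Type*} (o : V) (e : ι → V × V) : Matrix {x : V // x ≠ o} ι ℝ :=
  Matrix.of fun v i => bdry ℝ (e i) v

theorem famInc_transpose_mul_inv_mul {ι : Type*} (G : SimpleGraph V) (w : Sym2 V → ℝ) (o : V)
    (e : ι → V × V) (i j : ι) :
    ((famInc o e)ᵀ * (redLap G w o)⁻¹ * famInc o e) i j
      = redLapInv G w o (e i).1 (e j).1 - redLapInv G w o (e i).2 (e j).1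
        - redLapInv G w o (e i).1 (e j).2 + redLapInv G w o (e i).2 (e j).2 := by
  have hl (v : V) : redLapInv G w o o v = 0 := by simp [redLapInv]
  have hr (u : V) : redLapInv G w o u o = 0 := by simp [redLapInv]
  have h1 (b : {x : V // x ≠ o}) : ((famInc o e)ᵀ * (redLap G w o)⁻¹) i b
      = redLapInv G w o (e i).1 b - redLapInv G w o (e i).2 b := by
    rw [mul_apply, ← sum_mul_bdry o (fun u => redLapInv G w o u b) (hl _)]
    refine Finset.sum_congr rfl fun a _ => ?_
    rw [redLapInv_eq, mul_comm]
    rfl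
  rw [mul_apply]
  simp only [h1]
  refine (sum_mul_bdry o (fun v => redLapInv G w o (e i).1 v - redLapInv G w o (e i).2 v)
    (by simp [hr]) (e j)).trans ?_
  ring

theorem redLap_reweight {ι : Type*} [Fintype ι] [DecidableEq ι] (G : SimpleGraph V)
    (w : Sym2 V → ℝ) (o : V) (e : ι → V × V) (hadj : ∀ i, G.Adj (e i).1 (e i).2)
    (hinj : Function.Injective fun i => s((e i).1, (e i).2)) (t : ℝ) :
    redLap G (fun a => if ∃ i, s((e i).1, (e i).2) = a then (1 + t) * w a else w a) o
      = redLap G w o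
        + famInc o e * (t • (diagonal (fun i => w s((e i).1, (e i).2)) * (famInc o e)ᵀ)) := by
  ext u v
  rw [Matrix.add_apply, redLap_eq, redLap_eq, mul_apply, mul_apply, mul_apply]
  simp only [Matrix.smul_apply, mul_diagonal, diagonal_mul, transpose_apply, smul_eq_mul]
  rw [← sub_eq_iff_eq_add', ← Finset.sum_sub_distrib]
  have himg : ∑ i, famInc o e u i * (t * (w s((e i).1, (e i).2) * famInc o e v i))
      = ∑ a ∈ Finset.univ.image (fun i => s((e i).1, (e i).2)),
          t * (redInc ℝ o u a * edgeWeight G w a * redInc ℝ o v a) := by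
    rw [Finset.sum_image hinj.injOn]
    refine Finset.sum_congr rfl fun i _ => ?_
    rw [mul_right_comm (redInc ℝ o u _), redInc_mul_redInc, edgeWeight,
      if_pos ((SimpleGraph.mem_edgeSet G).2 (hadj i))]
    simp only [famInc, of_apply]
    ring
  rw [himg, ← Finset.sum_subset (Finset.subset_univ _) fun a _ ha => ?_]
  · refine Finset.sum_congr rfl fun a ha => ?_
    simp only [Finset.mem_image, Finset.mem_univ, true_and] at ha
    simp only [edgeWeight, if_pos ha]
    split_ifs <;> ring
  · simp only [Finset.mem_image, Finset.mem_univ, true_and] at ha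
    simp only [edgeWeight, if_neg ha, sub_self]

theorem pow_mul_treeSum {ι : Type*} [Fintype ι] (G : SimpleGraph V)
    (w : Sym2 V → ℝ) (e : ι → Sym2 V) (hinj : Function.Injective e) (s : ℝ) (hs : s ≠ 0) :
    s ^ Fintype.card ι * treeSum G (fun a => if ∃ i, e i = a then (1 + s⁻¹) * w a else w a)
        (fun _ => True)
      = ∑ T : SimpleGraph V, if T ≤ G ∧ T.IsTree then
          (∏ a ∈ Finset.univ.filter (· ∈ T.edgeSet), w a)
            * ∏ i, (if e i ∈ T.edgeSet then s + 1 else s) else 0 := by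
  rw [treeSum, Finset.mul_sum]
  refine Finset.sum_congr rfl fun T _ => ?_
  simp only [and_true]
  split_ifs with hT
  swap
  · simp
  have h1 (a : Sym2 V) : (if ∃ i, e i = a then (1 + s⁻¹) * w a else w a)
      = (if a ∈ Finset.univ.image e then 1 + s⁻¹ else 1) * w a := by
    simp only [Finset.mem_image, Finset.mem_univ, true_and]
    split_ifs <;> simp
  have h2 : ∏ a ∈ Finset.univ.filter (· ∈ T.edgeSet),
        (if a ∈ Finset.univ.image e then 1 + s⁻¹ else 1)
      = ∏ i, (if e i ∈ T.edgeSet then 1 + s⁻¹ else 1) := by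
    rw [← Finset.prod_filter, ← Finset.prod_image (s := Finset.univ) (g := e)
      (f := fun a => if a ∈ T.edgeSet then 1 + s⁻¹ else 1) hinj.injOn, ← Finset.prod_filter]
    congr 1
    ext a
    simp [and_comm]
  simp only [h1]
  rw [Finset.prod_mul_distrib, h2, ← Finset.card_univ, ← Finset.prod_const, ← mul_assoc,
    ← Finset.prod_mul_distrib, mul_comm]
  congr 1
  refine Finset.prod_congr rfl fun i _ => ?_
  split_ifs
  · field_simp
  · simp

theorem treeSum_forall_mem {ι : Type*} [Fintype ι] [DecidableEq ι] (G : SimpleGraph V)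
    (w : Sym2 V → ℝ) (o : V) (hO : IsUnit (redLap G w o).det) (e : ι → V × V)
    (hadj : ∀ i, G.Adj (e i).1 (e i).2)
    (hinj : Function.Injective fun i => s((e i).1, (e i).2)) :
    treeSum G w (fun T => ∀ i, s((e i).1, (e i).2) ∈ T.edgeSet)
      = treeSum G w (fun _ => True)
        * (diagonal (fun i => w s((e i).1, (e i).2))
            * ((famInc o e)ᵀ * (redLap G w o)⁻¹ * famInc o e)).det := by
  set D := diagonal (fun i => w s((e i).1, (e i).2)) with hD
  set U := famInc o e with hU
  set O := redLap G w o with hOdef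
  have hne (s : ℝ) (hs : s ≠ 0) :
      (∑ T : SimpleGraph V, if T ≤ G ∧ T.IsTree then
          (∏ a ∈ Finset.univ.filter (· ∈ T.edgeSet), w a)
            * ∏ i, (if s((e i).1, (e i).2) ∈ T.edgeSet then s + 1 else s) else 0)
        = treeSum G w (fun _ => True) * (s • 1 + D * (Uᵀ * O⁻¹ * U)).det := by
    rw [← pow_mul_treeSum G w (fun i => s((e i).1, (e i).2)) hinj s hs, ← det_redLap G _ o,
      ← det_redLap G w o, redLap_reweight G w o e hadj hinj]
    have h1 : O + U * (s⁻¹ • (D * Uᵀ)) = O * (1 + (O⁻¹ * U) * (s⁻¹ • (D * Uᵀ))) := by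
      rw [mul_add, mul_one, ← Matrix.mul_assoc, ← Matrix.mul_assoc, mul_nonsing_inv _ hO,
        Matrix.one_mul]
    have h2 : s • (1 + (s⁻¹ • (D * Uᵀ)) * (O⁻¹ * U)) = s • 1 + D * (Uᵀ * O⁻¹ * U) := by
      rw [smul_add, Matrix.smul_mul, smul_smul, mul_inv_cancel₀ hs, one_smul]
      simp only [Matrix.mul_assoc]
    rw [h1, det_mul, det_one_add_mul_comm, ← h2, det_smul]
    ring
  have hcont : (fun s : ℝ => ∑ T : SimpleGraph V, if T ≤ G ∧ T.IsTree then
          (∏ a ∈ Finset.univ.filter (· ∈ T.edgeSet), w a)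
            * ∏ i, (if s((e i).1, (e i).2) ∈ T.edgeSet then s + 1 else s) else 0)
      = fun s : ℝ => treeSum G w (fun _ => True) * (s • 1 + D * (Uᵀ * O⁻¹ * U)).det := by
    refine Continuous.ext_on (dense_compl_singleton (0 : ℝ)) ?_ ?_ fun s hs => hne s hs
    · refine continuous_finsetSum _ fun T _ => ?_
      split_ifs
      · refine continuous_const.mul (continuous_finsetProd _ fun i _ => ?_)
        split_ifs <;> fun_prop
      · exact continuous_const
    · exact continuous_const.mul (Continuous.matrix_det (by fun_prop))
  have h0 := congrFun hcont 0
  simp only [zero_smul, zero_add] at h0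
  rw [← h0, treeSum]
  refine Finset.sum_congr rfl fun T _ => ?_
  rw [Finset.prod_ite_zero]
  split_ifs <;> simp_all

end BurtonPemantle


/-- Burton–Pemantle theorem: for a finite connected weighted graph `G` and distinct
edges `e₁,…,e_k` (given with an orientation `eᵢ = (xᵢ → yᵢ)`), the probability under
the weighted uniform spanning tree measure that all the `eᵢ` belong to the tree equals
the determinant of the `k×k` transfer-impedance matrix
`T(eᵢ,eⱼ) = w_{eᵢ}·[O⁻¹(xᵢ,xⱼ) - O⁻¹(yᵢ,xⱼ) - O⁻¹(xᵢ,yⱼ) + O⁻¹(yᵢ,yⱼ)]`,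
where `O = -Δ_{o^c,o^c}` for a fixed root `o`. -/
theorem stmt_14 {V : Type*} [Fintype V] [DecidableEq V] (G : SimpleGraph V)
    (w : Sym2 V → ℝ) (hw : ∀ e ∈ G.edgeSet, 0 < w e)
    (hconn : G.Connected) (o : V) (k : ℕ) (e : Fin k → V × V)
    (hadj : ∀ i, G.Adj (e i).1 (e i).2)
    (hdist : ∀ i j, i ≠ j → s((e i).1, (e i).2) ≠ s((e j).1, (e j).2)) :
    treeSum G w (fun T => ∀ i, s((e i).1, (e i).2) ∈ T.edgeSet) /
        treeSum G w (fun _ => True)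
      = Matrix.det (Matrix.of fun i j : Fin k =>
          w s((e i).1, (e i).2) *
            (redLapInv G w o (e i).1 (e j).1 - redLapInv G w o (e i).2 (e j).1
              - redLapInv G w o (e i).1 (e j).2 + redLapInv G w o (e i).2 (e j).2)) := by
  have hZ := BurtonPemantle.treeSum_pos G w hw hconn
  have hinj : Function.Injective fun i => s((e i).1, (e i).2) := fun i j hij => by
    by_contra hne
    exact hdist i j hne hij
  have hO : IsUnit (BurtonPemantle.redLap G w o).det := by
    rw [BurtonPemantle.det_redLap]
    exact hZ.ne'.isUnit
  rw [BurtonPemantle.treeSum_forall_mem G w o hO e hadj hinj, mul_div_cancel_left₀ _ hZ.ne']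
  congr 1
  ext i j
  rw [Matrix.diagonal_mul, BurtonPemantle.famInc_transpose_mul_inv_mul]
  rfl

end
end

section
/- For a centered complex Gaussian vector Z with covariance E[Zᵢ Z̄ⱼ] = C(i,j) and E[ZᵢZⱼ]=0, the joint cumulant of the squared moduli satisfies κ(|Z_{x₁}|²,…,|Z_{x_k}|²) = Σ_{σ cyclic permutation of [k]} Π_{α=1}^k C(x_α, x_{σ(α)}); in particular the factor 1/2 present in the real Gaussian case is absent. -/
noncomputable section
open Classical MeasureTheory ProbabilityTheory

/-- The joint cumulant `κ(X₁,…,X_k)` defined via the partition (Möbius inversion)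
formula `κ = Σ_{π ∈ Π([k])} (|π|-1)! (-1)^{|π|-1} Π_{B ∈ π} E[Π_{i∈B} Xᵢ]`. -/
def jointCum {Ω : Type*} [MeasurableSpace Ω] {k : ℕ} (μ : Measure Ω)
    (X : Fin k → Ω → ℝ) : ℝ :=
  ∑ π : Finpartition (Finset.univ : Finset (Fin k)),
    (-1 : ℝ) ^ (π.parts.card - 1) * (π.parts.card - 1).factorial *
      ∏ B ∈ π.parts, ∫ ω, (∏ i ∈ B, X i ω) ∂μ

/-- The standard complex Gaussian measure on `ℂ` (with `E[|z|²] = 1`, i.e. real and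
imaginary parts independent centered Gaussians of variance `1/2`). -/
def stdComplexGaussian : Measure ℂ :=
  Measure.map (fun p : ℝ × ℝ => Complex.mk p.1 p.2)
    ((gaussianReal 0 (1 / 2)).prod (gaussianReal 0 (1 / 2)))

/-- Equivalences compatible with two colourings are families of equivalences between colour
classes. -/
def fiberEquivEquiv {α β γ : Type*} (f : α → γ) (g : β → γ) :
    (∀ c, {a // f a = c} ≃ {b // g b = c}) ≃ {σ : α ≃ β // ∀ a, g (σ a) = f a} where
  toFun e := ⟨Equiv.ofFiberEquiv e, Equiv.ofFiberEquiv_map e⟩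
  invFun σ c := σ.1.subtypeEquiv fun a => by rw [σ.2 a]
  left_inv e := by
    funext c
    ext ⟨a, rfl⟩
    rfl
  right_inv σ := by
    ext a
    rfl

/-- The product over colour classes of the permanents of the diagonal blocks is the sum over
colour-preserving permutations. -/
lemma prod_fiber_sum_perm {ι κ A : Type*} [Fintype ι] [DecidableEq ι] [Fintype κ]
    [DecidableEq κ] [CommRing A] (M : ι → ι → A) (h : ι → κ) :
    ∏ c, ∑ σ : Equiv.Perm {a // h a = c}, ∏ a : {a // h a = c}, M a (σ a)
      = ∑ σ : Equiv.Perm ι with ∀ a, h (σ a) = h a, ∏ a, M a (σ a) := by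
  rw [Fintype.prod_sum, ← Finset.sum_subtype_eq_sum_filter, Finset.subtype_univ]
  refine Fintype.sum_equiv (fiberEquivEquiv h h) _ _ fun e => ?_
  rw [← Fintype.prod_fiberwise h]
  refine Finset.prod_congr rfl fun c _ => Finset.prod_congr rfl ?_
  rintro ⟨a, rfl⟩ _
  rfl

/-- Counting colourings by their kernel partition. -/
lemma sum_descFactorial_mul_prod_parts {ι A : Type*} [Fintype ι] [DecidableEq ι] [CommRing A]
    (m : Finset ι → A) (hm : m ∅ = 1) (N : ℕ) :
    ∑ π : Finpartition (Finset.univ : Finset ι),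
        (N.descFactorial π.parts.card : A) * ∏ B ∈ π.parts, m B
      = ∑ h : ι → Fin N, ∏ c, m {a | h a = c} := by
  have key : ∀ π : Finpartition (Finset.univ : Finset ι),
      (N.descFactorial π.parts.card : A) * ∏ B ∈ π.parts, m B
        = ∑ _e : π.parts ↪ Fin N, ∏ B ∈ π.parts, m B := by
    intro π
    rw [Finset.sum_const, Finset.card_univ, Fintype.card_embedding_eq, nsmul_eq_mul,
      Fintype.card_fin, Fintype.card_coe]
  simp_rw [key]
  rw [← Fintype.sum_sigma']
  have hmem (π : Finpartition (Finset.univ : Finset ι)) (a : ι) : π.part a ∈ π.parts :=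
    π.part_mem.2 (Finset.mem_univ a)
  refine Fintype.sum_bijective
    (fun p : (π : Finpartition (Finset.univ : Finset ι)) × (π.parts ↪ Fin N) =>
      fun a => p.2 ⟨p.1.part a, hmem p.1 a⟩) ⟨?_, ?_⟩ _ _ ?_
  · rintro ⟨π, e⟩ ⟨π', e'⟩ h
    have hfib : ∀ a b, π.part a = π.part b ↔ π'.part a = π'.part b := by
      intro a b
      have ha := congrFun h a
      have hb := congrFun h b
      dsimp only at ha hb
      constructor
      · intro hab
        have : e' ⟨π'.part a, hmem π' a⟩ = e' ⟨π'.part b, hmem π' b⟩ := by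
          rw [← ha, ← hb]; simp only [hab]
        simpa using this
      · intro hab
        have : e ⟨π.part a, hmem π a⟩ = e ⟨π.part b, hmem π b⟩ := by
          rw [ha, hb]; simp only [hab]
        simpa using this
    have hpart : ∀ a, π.part a = π'.part a := by
      intro a
      ext b
      rw [π.mem_part_iff_part_eq_part (Finset.mem_univ b) (Finset.mem_univ a), hfib,
        π'.mem_part_iff_part_eq_part (Finset.mem_univ b) (Finset.mem_univ a)]
    have hparts (ρ : Finpartition (Finset.univ : Finset ι)) (B : Finset ι) :
        B ∈ ρ.parts ↔ ∃ a, ρ.part a = B := by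
      constructor
      · intro hB
        obtain ⟨a, ha⟩ := ρ.nonempty_of_mem_parts hB
        exact ⟨a, ρ.part_eq_of_mem hB ha⟩
      · rintro ⟨a, rfl⟩
        exact hmem ρ a
    obtain rfl : π = π' := by
      ext B
      rw [hparts, hparts]
      simp only [hpart]
    congr 1
    ext ⟨B, hB⟩
    obtain ⟨a, rfl⟩ := (hparts π B).1 hB
    exact congrArg Fin.val (congrFun h a)
  · intro h
    let π := Finpartition.ofSetoid (Setoid.ker h)
    have hmemπ : ∀ a b, b ∈ π.part a ↔ h a = h b := fun a b => by
      rw [Finpartition.mem_part_ofSetoid_iff_rel, Setoid.ker_def]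
    have hconst : ∀ B ∈ π.parts, ∀ a ∈ B, ∀ b, b ∈ B ↔ h a = h b := by
      intro B hB a ha b
      rw [← hmemπ, π.part_eq_of_mem hB ha]
    choose r hr using fun B : π.parts => π.nonempty_of_mem_parts B.2
    refine ⟨⟨π, ⟨fun B => h (r B), ?_⟩⟩, ?_⟩
    · intro B B' hBB
      exact Subtype.ext (π.eq_of_mem_parts B.2 B'.2
        ((hconst B.1 B.2 _ (hr B) _).2 hBB) (hr B'))
    · funext a
      exact ((hmemπ a _).1 (hr ⟨π.part a, hmem π a⟩)).symm
  · rintro ⟨π, e⟩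
    rw [← Finset.prod_coe_sort]
    refine Fintype.prod_of_injective e e.injective _ _ ?_ ?_
    · intro c hc
      rw [Finset.filter_eq_empty_iff.2, hm]
      intro a _ hac
      exact hc ⟨_, hac⟩
    · intro B
      congr 1
      ext a
      simp only [Finset.mem_filter, Finset.mem_univ, true_and, e.injective.eq_iff,
        Subtype.ext_iff]
      exact (π.part_eq_iff_mem B.2).symm

/-- The number of colourings invariant under a permutation. -/
lemma card_invariant_colorings {ι : Type*} [Fintype ι] [DecidableEq ι] (σ : Equiv.Perm ι)
    (N : ℕ) :
    Fintype.card {h : ι → Fin N // ∀ a, h (σ a) = h a}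
      = N ^ Fintype.card (Quotient (Equiv.Perm.SameCycle.setoid σ)) := by
  let e : {h : ι → Fin N // ∀ a, h (σ a) = h a}
      ≃ (Quotient (Equiv.Perm.SameCycle.setoid σ) → Fin N) :=
    { toFun := fun h => Quotient.lift h.1 (by
        intro a b hab
        obtain ⟨n, -, rfl⟩ := Equiv.Perm.SameCycle.exists_pow_eq' (f := σ) hab
        induction n with
        | zero => rfl
        | succ n ih => rw [pow_succ', Equiv.Perm.mul_apply, h.2]; exact ih ⟨n, by simp⟩)
      invFun := fun q => ⟨fun a => q ⟦a⟧, fun a => congrArg q (Quotient.sound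
        (show σ.SameCycle (σ a) a from Equiv.Perm.sameCycle_apply_left.2 (.refl _ _)))⟩
      left_inv := fun h => rfl
      right_inv := fun q => by
        funext x
        induction x using Quotient.inductionOn
        rfl }
  rw [Fintype.card_congr e, Fintype.card_fun, Fintype.card_fin]

/-- If `m B` is the permanent of the block `B`, the factorial moments weighted over partitions
equal the cycle-counting polynomial at `N`. -/
lemma sum_descFactorial_mul_prod_permanent {ι A : Type*} [Fintype ι] [DecidableEq ι]
    [CommRing A] (M : ι → ι → A) (N : ℕ) :
    ∑ π : Finpartition (Finset.univ : Finset ι), (N.descFactorial π.parts.card : A) *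
        ∏ B ∈ π.parts, ∑ σ : Equiv.Perm {a // a ∈ B}, ∏ a : {a // a ∈ B}, M a (σ a)
      = ∑ σ : Equiv.Perm ι,
          (N : A) ^ Fintype.card (Quotient (Equiv.Perm.SameCycle.setoid σ)) *
            ∏ a, M a (σ a) := by
  rw [sum_descFactorial_mul_prod_parts
    (fun B : Finset ι => ∑ σ : Equiv.Perm {a // a ∈ B}, ∏ a : {a // a ∈ B}, M a (σ a)) (by simp)]
  have hfib (h : ι → Fin N) (c : Fin N) :
      ∑ σ : Equiv.Perm {a // a ∈ (Finset.univ.filter fun a => h a = c)},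
          ∏ a : {a // a ∈ (Finset.univ.filter fun a => h a = c)}, M a (σ a)
        = ∑ σ : Equiv.Perm {a // h a = c}, ∏ a : {a // h a = c}, M a (σ a) := by
    let e : {a // a ∈ (Finset.univ.filter fun a => h a = c)} ≃ {a // h a = c} :=
      Equiv.subtypeEquivRight (by simp)
    refine Fintype.sum_equiv e.permCongr _ _ fun σ => ?_
    refine Fintype.prod_equiv e _ _ fun a => ?_
    rw [Equiv.permCongr_apply, e.symm_apply_apply]
    rfl
  simp_rw [hfib, prod_fiber_sum_perm, Finset.sum_filter]
  rw [Finset.sum_comm]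
  refine Finset.sum_congr rfl fun σ _ => ?_
  rw [← Finset.sum_filter, Finset.sum_const, nsmul_eq_mul, ← Nat.cast_pow,
    ← card_invariant_colorings, Fintype.card_subtype]

lemma descPochhammer_coeff_one (n : ℕ) :
    (descPochhammer ℂ (n + 1)).coeff 1 = (-1) ^ n * n.factorial := by
  have h : ∀ n : ℕ, (descPochhammer ℂ n).eval (-1) = (-1) ^ n * n.factorial := by
    intro n
    induction n with
    | zero => simp
    | succ n ih =>
      rw [descPochhammer_succ_eval, ih, Nat.factorial_succ]
      push_cast
      ring
  rw [descPochhammer_succ_left, Polynomial.coeff_X_mul, Polynomial.coeff_zero_eq_eval_zero,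
    Polynomial.eval_comp]
  simpa using h n

lemma card_sameCycle_quotient_eq_one_iff {k : ℕ} (hk : k ≠ 0) (σ : Equiv.Perm (Fin k)) :
    Fintype.card (Quotient (Equiv.Perm.SameCycle.setoid σ)) = 1
      ↔ ∀ i j : Fin k, ∃ m : ℕ, (σ ^ m) i = j := by
  rw [Fintype.card_eq_one_iff]
  constructor
  · rintro ⟨x, hx⟩ i j
    have hij : σ.SameCycle i j := Quotient.exact
      (s := Equiv.Perm.SameCycle.setoid σ) ((hx ⟦i⟧).trans (hx ⟦j⟧).symm)
    obtain ⟨m, -, hm⟩ := hij.exists_pow_eq'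
    exact ⟨m, hm⟩
  · intro h
    refine ⟨⟦⟨0, Nat.pos_of_ne_zero hk⟩⟧, fun y => ?_⟩
    induction y using Quotient.inductionOn with
    | h a =>
      obtain ⟨m, hm⟩ := h a ⟨0, Nat.pos_of_ne_zero hk⟩
      exact Quotient.sound (s := Equiv.Perm.SameCycle.setoid σ) ⟨m, by simpa using hm⟩

/-- Möbius inversion of permanents over set partitions leaves the sum over full cycles. -/
lemma sum_mobius_prod_permanent {k : ℕ} (M : Fin k → Fin k → ℂ) :
    ∑ π : Finpartition (Finset.univ : Finset (Fin k)),
        (-1 : ℂ) ^ (π.parts.card - 1) * (π.parts.card - 1).factorial *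
          ∏ B ∈ π.parts, ∑ σ : Equiv.Perm {a // a ∈ B}, ∏ a : {a // a ∈ B}, M a (σ a)
      = ∑ σ : Equiv.Perm (Fin k) with ∀ i j : Fin k, ∃ m : ℕ, (σ ^ m) i = j,
          ∏ a, M a (σ a) := by
  rcases eq_or_ne k 0 with rfl | hk
  · have hparts (π : Finpartition (Finset.univ : Finset (Fin 0))) : π.parts.card = 0 := by
      rw [Finset.card_eq_zero, π.parts_eq_empty_iff]
      rfl
    have h := sum_descFactorial_mul_prod_permanent M 1
    simp only [hparts] at h ⊢
    simpa using h
  · let P : Polynomial ℂ := ∑ π : Finpartition (Finset.univ : Finset (Fin k)),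
      descPochhammer ℂ π.parts.card * Polynomial.C
        (∏ B ∈ π.parts, ∑ σ : Equiv.Perm {a // a ∈ B}, ∏ a : {a // a ∈ B}, M a (σ a))
    let Q : Polynomial ℂ := ∑ σ : Equiv.Perm (Fin k),
      Polynomial.X ^ Fintype.card (Quotient (Equiv.Perm.SameCycle.setoid σ)) *
        Polynomial.C (∏ a, M a (σ a))
    have hPQ : P = Q := by
      refine Polynomial.eq_of_infinite_eval_eq P Q
        ((Set.infinite_range_of_injective (Nat.cast_injective (R := ℂ))).mono ?_)
      rintro _ ⟨N, rfl⟩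
      simpa only [P, Q, Set.mem_ofPred_eq, Polynomial.eval_finsetSum, Polynomial.eval_mul,
        Polynomial.eval_C, Polynomial.eval_pow, Polynomial.eval_X,
        descPochhammer_eval_eq_descFactorial] using sum_descFactorial_mul_prod_permanent M N
    have h1 := congrArg (Polynomial.coeff · 1) hPQ
    simp only [P, Q, Polynomial.finsetSum_coeff, Polynomial.coeff_mul_C,
      Polynomial.coeff_X_pow] at h1
    rw [Finset.sum_filter]
    refine Eq.trans (Finset.sum_congr rfl fun π _ => ?_)
      (h1.trans (Finset.sum_congr rfl fun σ _ => ?_))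
    · obtain ⟨n, hn⟩ : ∃ n, π.parts.card = n + 1 := by
        refine Nat.exists_eq_succ_of_ne_zero (Finset.card_ne_zero.2 ?_)
        exact ⟨_, π.part_mem.2 (Finset.mem_univ ⟨0, Nat.pos_of_ne_zero hk⟩)⟩
      rw [hn, descPochhammer_coeff_one, Nat.add_sub_cancel]
    · simp only [eq_comm (a := 1), card_sameCycle_quotient_eq_one_iff hk, ite_mul, one_mul,
        zero_mul]

instance : IsProbabilityMeasure stdComplexGaussian := by
  unfold stdComplexGaussian
  refine Measure.isProbabilityMeasure_map ?_
  exact (Complex.measurableEquivRealProd.symm.measurable).aemeasurable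

lemma memLp_id_stdComplexGaussian (p : NNReal) : MemLp id (p : ENNReal) stdComplexGaussian := by
  unfold stdComplexGaussian
  have hmeas : Measurable (fun q : ℝ × ℝ => Complex.mk q.1 q.2) :=
    Complex.measurableEquivRealProd.symm.measurable
  rw [memLp_map_measure_iff aestronglyMeasurable_id hmeas.aemeasurable]
  have h1 : MemLp (fun q : ℝ × ℝ => q.1) p
      ((gaussianReal 0 (1 / 2)).prod (gaussianReal 0 (1 / 2))) :=
    (memLp_id_gaussianReal p).comp_measurePreserving measurePreserving_fst
  have h2 : MemLp (fun q : ℝ × ℝ => q.2) p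
      ((gaussianReal 0 (1 / 2)).prod (gaussianReal 0 (1 / 2))) :=
    (memLp_id_gaussianReal p).comp_measurePreserving measurePreserving_snd
  refine (h1.norm.add h2.norm).mono hmeas.aestronglyMeasurable (Filter.Eventually.of_forall ?_)
  intro q
  refine (Complex.norm_le_abs_re_add_abs_im _).trans (le_of_eq ?_)
  exact (abs_of_nonneg (add_nonneg (norm_nonneg q.1) (norm_nonneg q.2))).symm

lemma integrable_pow_mul_conj_pow (a b : ℕ) :
    Integrable (fun z : ℂ => z ^ a * (starRingEnd ℂ z) ^ b) stdComplexGaussian := by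
  rcases Nat.eq_zero_or_pos (a + b) with h | h
  · obtain ⟨rfl, rfl⟩ : a = 0 ∧ b = 0 := by omega
    simp
  · have hi := (memLp_id_stdComplexGaussian ((a + b : ℕ) : NNReal))
    have hi' := (show MemLp id ((a + b : ℕ) : ENNReal) stdComplexGaussian by
      simpa using hi).integrable_norm_pow h.ne'
    refine hi'.mono' (by fun_prop) (Filter.Eventually.of_forall fun z => ?_)
    simp [pow_add]

lemma integral_stdComplexGaussian (f : ℂ → ℂ) (hf : Measurable f) :
    ∫ z, f z ∂stdComplexGaussian
      = ∫ p : ℝ × ℝ, ((Real.pi⁻¹ * Real.exp (-(p.1 ^ 2 + p.2 ^ 2)) : ℝ) : ℂ)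
          * f (Complex.mk p.1 p.2) := by
  unfold stdComplexGaussian
  have hmeas : Measurable (fun q : ℝ × ℝ => Complex.mk q.1 q.2) :=
    Complex.measurableEquivRealProd.symm.measurable
  rw [integral_map hmeas.aemeasurable hf.aestronglyMeasurable]
  rw [gaussianReal_of_var_ne_zero _ (by norm_num), prod_withDensity (by fun_prop) (by fun_prop),
    integral_withDensity_eq_integral_toReal_smul (by fun_prop)
      (Filter.Eventually.of_forall fun p =>
        ENNReal.mul_lt_top gaussianPDF_lt_top gaussianPDF_lt_top)]
  refine integral_congr_ae (Filter.Eventually.of_forall fun p => ?_)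
  dsimp only
  rw [ENNReal.toReal_mul, toReal_gaussianPDF, toReal_gaussianPDF, Complex.real_smul]
  congr 2
  simp only [gaussianPDFReal, sub_zero]
  rw [mul_mul_mul_comm, ← Real.exp_add, ← mul_inv, Real.mul_self_sqrt (by positivity)]
  norm_num
  rw [Real.exp_add, Real.exp_add]
  ring

lemma integral_exp_int_mul_I (a b : ℕ) :
    ∫ t : ℝ in Set.Ioo (-Real.pi) Real.pi,
        Complex.exp (((a : ℂ) - b) * Complex.I * t)
      = if a = b then (2 * Real.pi : ℂ) else 0 := by
  rw [← integral_Ioc_eq_integral_Ioo,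
    ← intervalIntegral.integral_of_le (by linarith [Real.pi_pos])]
  split_ifs with h
  · subst h
    simp
    ring
  · have hab : (a : ℂ) - b ≠ 0 := sub_ne_zero.2 (by exact_mod_cast h)
    rw [integral_exp_mul_complex (mul_ne_zero hab Complex.I_ne_zero)]
    refine div_eq_zero_iff.2 (Or.inl (sub_eq_zero.2 ?_))
    rw [Complex.exp_eq_exp_iff_exists_int]
    exact ⟨(a : ℤ) - b, by push_cast; ring⟩

/-- The mixed moments of the standard complex Gaussian. -/
lemma integral_pow_mul_conj_pow (a b : ℕ) :
    ∫ z : ℂ, z ^ a * (starRingEnd ℂ z) ^ b ∂stdComplexGaussian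
      = if a = b then (a.factorial : ℂ) else 0 := by
  rw [integral_stdComplexGaussian _ (by fun_prop), ← integral_comp_polarCoord_symm]
  have hrw : ∀ p ∈ polarCoord.target,
      p.1 • (((Real.pi⁻¹ * Real.exp (-((polarCoord.symm p).1 ^ 2 + (polarCoord.symm p).2 ^ 2))
          : ℝ) : ℂ) * (Complex.mk (polarCoord.symm p).1 (polarCoord.symm p).2 ^ a *
            starRingEnd ℂ (Complex.mk (polarCoord.symm p).1 (polarCoord.symm p).2) ^ b))
        = ((Real.pi⁻¹ * (p.1 ^ (a + b + 1) * Real.exp (-p.1 ^ 2)) : ℝ) : ℂ)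
          * Complex.exp (((a : ℂ) - b) * Complex.I * p.2) := by
    intro p _
    have hz : Complex.mk (polarCoord.symm p).1 (polarCoord.symm p).2
        = p.1 * Complex.exp (p.2 * Complex.I) := by
      apply Complex.ext <;>
        simp [polarCoord_symm_apply, Complex.exp_ofReal_mul_I_re, Complex.exp_ofReal_mul_I_im]
    have hsq : (polarCoord.symm p).1 ^ 2 + (polarCoord.symm p).2 ^ 2 = p.1 ^ 2 := by
      rw [polarCoord_symm_apply]
      linear_combination p.1 ^ 2 * Real.sin_sq_add_cos_sq p.2
    have he : Complex.exp (((a : ℂ) - b) * Complex.I * p.2)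
        = Complex.exp (p.2 * Complex.I) ^ a * Complex.exp (-(p.2 * Complex.I)) ^ b := by
      rw [← Complex.exp_nat_mul, ← Complex.exp_nat_mul, ← Complex.exp_add]
      congr 1
      ring
    rw [hz, hsq, he, map_mul, Complex.conj_ofReal, ← Complex.exp_conj, map_mul,
      Complex.conj_ofReal, Complex.conj_I, Complex.real_smul]
    push_cast
    rw [mul_neg]
    ring
  have hmeas : MeasurableSet polarCoord.target := polarCoord.open_target.measurableSet
  rw [setIntegral_congr_fun hmeas hrw, polarCoord_target, Measure.volume_eq_prod,
    setIntegral_prod_mul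
      (fun r : ℝ => ((Real.pi⁻¹ * (r ^ (a + b + 1) * Real.exp (-r ^ 2)) : ℝ) : ℂ))
      (fun t : ℝ => Complex.exp (((a : ℂ) - b) * Complex.I * t)),
    integral_exp_int_mul_I]
  split_ifs with h
  · subst h
    have hG := integral_rpow_mul_exp_neg_rpow (p := 2) (q := (a + a + 1 : ℕ)) (by norm_num)
      (by have : (0 : ℝ) ≤ ((a + a + 1 : ℕ) : ℝ) := Nat.cast_nonneg _
          linarith)
    rw [show (((a + a + 1 : ℕ) : ℝ) + 1) / 2 = a + 1 by push_cast; ring,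
      Real.Gamma_nat_eq_factorial] at hG
    simp only [Real.rpow_natCast, Real.rpow_two] at hG
    rw [integral_complex_ofReal, integral_const_mul, hG]
    push_cast
    field_simp
  · rw [mul_zero]

/-- The number of permutations carrying one colouring to another. -/
lemma card_perm_map_coloring {ι κ : Type*} [Fintype ι] [DecidableEq ι] [Fintype κ]
    [DecidableEq κ] (f g : ι → κ) :
    (Fintype.card {σ : Equiv.Perm ι // ∀ a, g (σ a) = f a} : ℂ)
      = ∏ c, if Fintype.card {a // f a = c} = Fintype.card {a // g a = c} then
          ((Fintype.card {a // f a = c}).factorial : ℂ) else 0 := by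
  rw [← Fintype.card_congr (fiberEquivEquiv f g), Fintype.card_pi, Nat.cast_prod]
  refine Finset.prod_congr rfl fun c _ => ?_
  split_ifs with h
  · rw [Fintype.card_equiv (Fintype.equivOfCardEq h)]
  · have : IsEmpty ({a // f a = c} ≃ {a // g a = c}) := ⟨fun e => h (Fintype.card_congr e)⟩
    simp

lemma prod_apply_eq_prod_pow {ι κ A : Type*} [Fintype ι] [Fintype κ] [DecidableEq κ]
    [CommRing A] (f : ι → κ) (z : κ → A) :
    ∏ i, z (f i) = ∏ j, z j ^ Fintype.card {a // f a = j} := by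
  rw [← Fintype.prod_fiberwise f]
  refine Finset.prod_congr rfl fun j _ => ?_
  rw [Finset.prod_congr rfl (fun (i : {a // f a = j}) _ => congrArg z i.2), Finset.prod_const,
    Finset.card_univ]

lemma integral_prod_mul_prod_conj {ι κ : Type*} [Fintype ι] [DecidableEq ι] [Fintype κ]
    [DecidableEq κ] (f g : ι → κ) :
    Integrable (fun z : κ → ℂ => (∏ i, z (f i)) * ∏ i, starRingEnd ℂ (z (g i)))
        (Measure.pi fun _ : κ => stdComplexGaussian) ∧
      ∫ z : κ → ℂ, (∏ i, z (f i)) * ∏ i, starRingEnd ℂ (z (g i))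
          ∂(Measure.pi fun _ : κ => stdComplexGaussian)
        = ∑ σ : Equiv.Perm ι, if ∀ a, g (σ a) = f a then (1 : ℂ) else 0 := by
  have hrw (z : κ → ℂ) : (∏ i, z (f i)) * ∏ i, starRingEnd ℂ (z (g i))
      = ∏ j, (z j ^ Fintype.card {a // f a = j} *
          starRingEnd ℂ (z j) ^ Fintype.card {a // g a = j}) := by
    rw [prod_apply_eq_prod_pow f z, prod_apply_eq_prod_pow g (fun j => starRingEnd ℂ (z j)),
      Finset.prod_mul_distrib]
  simp_rw [hrw]
  constructor
  · exact Integrable.fintype_prod (f := fun j (w : ℂ) => w ^ Fintype.card {a // f a = j} *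
          starRingEnd ℂ w ^ Fintype.card {a // g a = j})
      fun j => integrable_pow_mul_conj_pow _ _
  · rw [integral_fintype_prod_eq_prod (fun j (w : ℂ) => w ^ Fintype.card {a // f a = j} *
          starRingEnd ℂ w ^ Fintype.card {a // g a = j})]
    simp_rw [integral_pow_mul_conj_pow]
    rw [← card_perm_map_coloring, Fintype.card_subtype, Finset.sum_boole]

/-- Wick's formula for the squared moduli of a complex Gaussian vector. -/
lemma integral_prod_normSq {ι κ : Type*} [Fintype ι] [DecidableEq ι] [Fintype κ]
    [DecidableEq κ] (R : Matrix ι κ ℂ) :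
    ∫ z : κ → ℂ, ∏ i, (Complex.normSq (∑ j, R i j * z j) : ℂ)
        ∂(Measure.pi fun _ : κ => stdComplexGaussian)
      = ∑ σ : Equiv.Perm ι, ∏ i, (R * R.conjTranspose) i (σ i) := by
  have hrw (z : κ → ℂ) : ∏ i, (Complex.normSq (∑ j, R i j * z j) : ℂ)
      = ∑ f : ι → κ, ∑ g : ι → κ, ((∏ i, R i (f i)) * ∏ i, starRingEnd ℂ (R i (g i))) *
          ((∏ i, z (f i)) * ∏ i, starRingEnd ℂ (z (g i))) := by
    simp_rw [← Complex.mul_conj, map_sum, map_mul]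
    rw [Finset.prod_mul_distrib, Fintype.prod_sum, Fintype.prod_sum, Finset.sum_mul_sum]
    refine Finset.sum_congr rfl fun f _ => Finset.sum_congr rfl fun g _ => ?_
    rw [Finset.prod_mul_distrib, Finset.prod_mul_distrib]
    ring
  have hint (f g : ι → κ) := (integral_prod_mul_prod_conj f g).1.const_mul
    ((∏ i, R i (f i)) * ∏ i, starRingEnd ℂ (R i (g i)))
  simp_rw [hrw]
  rw [integral_finsetSum _ fun f _ => integrable_finsetSum _ fun g _ => hint f g]
  simp_rw [integral_finsetSum _ fun g _ => hint _ g, integral_const_mul,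
    (integral_prod_mul_prod_conj _ _).2, Finset.mul_sum]
  have hcomm (F : (ι → κ) → (ι → κ) → Equiv.Perm ι → ℂ) :
      ∑ f, ∑ g, ∑ σ, F f g σ = ∑ σ, ∑ f, ∑ g, F f g σ := by
    rw [Finset.sum_comm (f := fun σ f => ∑ g, F f g σ)]
    exact Finset.sum_congr rfl fun f _ => Finset.sum_comm
  rw [hcomm]
  refine Finset.sum_congr rfl fun σ _ => ?_
  simp_rw [Matrix.mul_apply, Matrix.conjTranspose_apply]
  rw [Fintype.prod_sum]
  refine Finset.sum_congr rfl fun f _ => ?_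
  rw [Finset.sum_eq_single (f ∘ σ.symm)]
  · rw [if_pos (by simp), mul_one, Finset.prod_mul_distrib]
    congr 1
    rw [← Equiv.prod_comp σ]
    simp
  · intro g _ hg
    rw [if_neg, mul_zero]
    intro h
    refine hg (funext fun a => ?_)
    rw [Function.comp, ← h, σ.apply_symm_apply]
  · simp

/-- Cumulants of the squared moduli of a centered complex Gaussian vector: if `Z` is a
centered complex Gaussian vector with `E[Zᵢ Z̄ⱼ] = C(i,j)` and `E[ZᵢZⱼ] = 0` (realized
as `Z = R z` for `z` i.i.d. standard complex Gaussians with `R Rᴴ = C`), then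
`κ(|Z₁|²,…,|Z_k|²) = Σ_{σ single-cycle permutation of [k]} Π_α C(α, σ(α))`;
in particular the factor `1/2` of the real Gaussian case is absent. -/
theorem stmt_16 (k : ℕ) (C : Matrix (Fin k) (Fin k) ℂ) (R : Matrix (Fin k) (Fin k) ℂ)
    (hC : C.IsHermitian) (hCdet : C.det ≠ 0) (hR : R * R.conjTranspose = C) :
    (jointCum
        (Measure.map (fun z : Fin k → ℂ => fun i => ∑ j, R i j * z j)
          (Measure.pi fun _ : Fin k => stdComplexGaussian))
        (fun i z => Complex.normSq (z i)) : ℂ)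
      = ∑ σ ∈ Finset.univ.filter
            (fun σ : Equiv.Perm (Fin k) => ∀ i j : Fin k, ∃ m : ℕ, (σ ^ m) i = j),
          ∏ α : Fin k, C α (σ α) := by
  have hmeas : Measurable (fun z : Fin k → ℂ => fun i => ∑ j, R i j * z j) := by fun_prop
  have hmoment (B : Finset (Fin k)) :
      ((∫ z : Fin k → ℂ, ∏ i ∈ B, Complex.normSq (z i)
          ∂(Measure.map (fun z : Fin k → ℂ => fun i => ∑ j, R i j * z j)
            (Measure.pi fun _ : Fin k => stdComplexGaussian)) : ℝ) : ℂ)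
        = ∑ σ : Equiv.Perm {a // a ∈ B}, ∏ a : {a // a ∈ B}, C a (σ a) := by
    rw [integral_map hmeas.aemeasurable (by
      refine Measurable.aestronglyMeasurable (Finset.measurable_prod _ fun i _ => ?_)
      exact Complex.continuous_normSq.measurable.comp (measurable_pi_apply i)),
      ← integral_complex_ofReal]
    have h := integral_prod_normSq (R.submatrix (fun a : {a // a ∈ B} => (a : Fin k)) id)
    subst hR
    refine Eq.trans (integral_congr_ae (Filter.Eventually.of_forall fun z => ?_)) h
    simp only [Complex.ofReal_prod, Matrix.submatrix_apply, id]
    exact (Finset.prod_coe_sort B fun i => (Complex.normSq (∑ j, R i j * z j) : ℂ)).symm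
  unfold jointCum
  simp only [Complex.ofReal_sum, Complex.ofReal_mul, Complex.ofReal_pow, Complex.ofReal_neg,
    Complex.ofReal_one, Complex.ofReal_natCast, Complex.ofReal_prod, hmoment]
  convert sum_mobius_prod_permanent C

end
end
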